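/- arXiv:math/0408070 — 2 statements merged into one kernel-verified Lean document; each statement's English description precedes it below -/
import Mathlib

section
/- Define on ℝ⁴ the maps s(x,y,p,q) = (x,y), t(x,y,p,q) = (x e^p, y + x q), the unit ε(x,y) = (x,y,0,0), the inverse (x,y,p,q)⁻¹ = (x e^p, y + x q, −p, −q e^{−p}), and the partial multiplication (x,y,p,q)·(x',y',p',q') = (x, y, p+p', q + e^p q'), defined exactly when x' = x e^p and y' = y + x q (i.e. when t of the first factor equals s of the second). Then these data form a groupoid over ℝ²: (i) whenever t(g) = s(h), one has s(g·h) = s(g) and t(g·h) = t(h); (ii) the multiplication is associative whenever all products are defined; (iii) ε(s(g))·g = g = g·ε(t(g)); (iv) s(g⁻¹) = t(g), t(g⁻¹) = s(g), g·g⁻¹ = ε(s(g)) and g⁻¹·g = ε(t(g)). -/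
open Real

/-- Source map of the symplectic groupoid `Γ(ℝ²)` of `π = x ∂ₓ ∧ ∂_y`. -/
noncomputable def grpdSrc (g : ℝ × ℝ × ℝ × ℝ) : ℝ × ℝ := (g.1, g.2.1)

/-- Target map. -/
noncomputable def grpdTgt (g : ℝ × ℝ × ℝ × ℝ) : ℝ × ℝ :=
  (g.1 * Real.exp g.2.2.1, g.2.1 + g.1 * g.2.2.2)

/-- Unit map. -/
noncomputable def grpdUnit (u : ℝ × ℝ) : ℝ × ℝ × ℝ × ℝ := (u.1, u.2, 0, 0)

/-- Inverse map. -/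
noncomputable def grpdInv (g : ℝ × ℝ × ℝ × ℝ) : ℝ × ℝ × ℝ × ℝ :=
  (g.1 * Real.exp g.2.2.1, g.2.1 + g.1 * g.2.2.2, -g.2.2.1,
    -g.2.2.2 * Real.exp (-g.2.2.1))

/-- Partial multiplication `(x,y,p,q)·(x',y',p',q') = (x, y, p+p', q + e^p q')`,
defined (as a groupoid composition) exactly when `grpdTgt g = grpdSrc h`. -/
noncomputable def grpdMul (g h : ℝ × ℝ × ℝ × ℝ) : ℝ × ℝ × ℝ × ℝ :=
  (g.1, g.2.1, g.2.2.1 + h.2.2.1, g.2.2.2 + Real.exp g.2.2.1 * h.2.2.2)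

/-- The maps `s, t, ε, ⁻¹, ·` above form a groupoid over `ℝ²`. -/
theorem groupoid_structure_on_R4 :
    (∀ g h : ℝ × ℝ × ℝ × ℝ, grpdTgt g = grpdSrc h →
      grpdSrc (grpdMul g h) = grpdSrc g ∧ grpdTgt (grpdMul g h) = grpdTgt h) ∧
    (∀ g h k : ℝ × ℝ × ℝ × ℝ, grpdTgt g = grpdSrc h → grpdTgt h = grpdSrc k →
      grpdMul (grpdMul g h) k = grpdMul g (grpdMul h k)) ∧
    (∀ g : ℝ × ℝ × ℝ × ℝ,
      grpdMul (grpdUnit (grpdSrc g)) g = g ∧ grpdMul g (grpdUnit (grpdTgt g)) = g) ∧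
    (∀ g : ℝ × ℝ × ℝ × ℝ,
      grpdSrc (grpdInv g) = grpdTgt g ∧ grpdTgt (grpdInv g) = grpdSrc g ∧
      grpdMul g (grpdInv g) = grpdUnit (grpdSrc g) ∧
      grpdMul (grpdInv g) g = grpdUnit (grpdTgt g)) := by
  refine ⟨?_, ?_, ?_, ?_⟩
  · rintro ⟨x, y, p, q⟩ ⟨x₁, y₁, p₁, q₁⟩ hgh
    simp only [grpdTgt, grpdSrc, Prod.mk.injEq] at hgh
    obtain ⟨rfl, rfl⟩ := hgh
    refine ⟨rfl, ?_⟩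
    simp only [grpdTgt, grpdMul, Real.exp_add, Prod.mk.injEq]
    constructor <;> ring
  · rintro ⟨x, y, p, q⟩ ⟨x₁, y₁, p₁, q₁⟩ ⟨x₂, y₂, p₂, q₂⟩ - -
    simp only [grpdMul, Real.exp_add, Prod.mk.injEq, true_and]
    constructor <;> ring
  · rintro ⟨x, y, p, q⟩
    simp [grpdMul, grpdUnit, grpdSrc]
  · rintro ⟨x, y, p, q⟩
    have hp : Real.exp p * Real.exp (-p) = 1 := by
      rw [← Real.exp_add, add_neg_cancel, Real.exp_zero]
    simp only [grpdMul, grpdUnit, grpdSrc, grpdTgt, grpdInv, Prod.mk.injEq, true_and]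
    refine ⟨⟨?_, ?_⟩, ⟨?_, ?_⟩, ?_, ?_⟩
    · linear_combination x * hp
    · linear_combination -x * q * hp
    · ring
    · linear_combination -q * hp
    · ring
    · ring
end

section
/- Define α(r,p) = ((r+1) + (r−1)e^{2p}) / ((r+1) − (r−1)e^{2p}) and D(r,p) = (r+1) − (r−1)e^{2p} for real r, p. If D(r,p) ≠ 0 and D(r,p+p') ≠ 0, then D(α(r,p), p') ≠ 0 and α(α(r,p), p') = α(r, p+p'); i.e. α satisfies the flow (groupoid composition) law in the p-variable. -/
open Real

/-- The first component `α(r,p)` of the target map of the symplectic groupoid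
of `π = (r²−1) ∂_r∧∂_θ` on the cylinder. -/
noncomputable def alpha (r p : ℝ) : ℝ :=
  ((r + 1) + (r - 1) * Real.exp (2 * p)) / ((r + 1) - (r - 1) * Real.exp (2 * p))

/-- The denominator `D(r,p) = (r+1) − (r−1)e^{2p}`. -/
noncomputable def Dden (r p : ℝ) : ℝ :=
  (r + 1) - (r - 1) * Real.exp (2 * p)

theorem alpha_add_one {r p : ℝ} (h : Dden r p ≠ 0) :
    alpha r p + 1 = 2 * (r + 1) / Dden r p := by
  unfold alpha Dden at *
  rw [div_add_one h]
  ring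

theorem alpha_sub_one {r p : ℝ} (h : Dden r p ≠ 0) :
    alpha r p - 1 = 2 * ((r - 1) * Real.exp (2 * p)) / Dden r p := by
  unfold alpha Dden at *
  rw [div_sub_one h]
  ring

theorem Dden_alpha {r p : ℝ} (p' : ℝ) (h : Dden r p ≠ 0) :
    Dden (alpha r p) p' = 2 / Dden r p * Dden r (p + p') := by
  rw [Dden, alpha_add_one h, alpha_sub_one h, Dden.eq_1 r (p + p'), mul_add 2 p, Real.exp_add]
  ring

/-- `α` satisfies the flow (groupoid composition) law in the `p`-variable:
if `D(r,p) ≠ 0` and `D(r,p+p') ≠ 0` then `D(α(r,p),p') ≠ 0` and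
`α(α(r,p),p') = α(r,p+p')`. -/
theorem alpha_flow_law (r p p' : ℝ) (h1 : Dden r p ≠ 0) (h2 : Dden r (p + p') ≠ 0) :
    Dden (alpha r p) p' ≠ 0 ∧ alpha (alpha r p) p' = alpha r (p + p') := by
  have hc : 2 / Dden r p ≠ 0 := div_ne_zero two_ne_zero h1
  refine ⟨Dden_alpha p' h1 ▸ mul_ne_zero hc h2, ?_⟩
  have hnum : (alpha r p + 1) + (alpha r p - 1) * Real.exp (2 * p') =
      2 / Dden r p * ((r + 1) + (r - 1) * Real.exp (2 * (p + p'))) := by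
    rw [alpha_add_one h1, alpha_sub_one h1, mul_add 2 p, Real.exp_add]
    ring
  calc alpha (alpha r p) p'
      = ((alpha r p + 1) + (alpha r p - 1) * Real.exp (2 * p')) / Dden (alpha r p) p' := rfl
    _ = ((r + 1) + (r - 1) * Real.exp (2 * (p + p'))) / Dden r (p + p') := by
      rw [hnum, Dden_alpha p' h1, mul_div_mul_left _ _ hc]
    _ = alpha r (p + p') := rfl
end
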